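/- For all x, y ∈ [0,1], h(xy) ≥ (1/(2φ))·(x·h(y) + y·h(x)). -/

import Mathlib

/-- The binary entropy function (base 2), extended by `h 0 = h 1 = 0`
(note `Real.logb 2 0 = 0` by convention). -/
noncomputable def binEnt (x : ℝ) : ℝ :=
  -(x * Real.logb 2 x) - (1 - x) * Real.logb 2 (1 - x)

open Real Set

lemma binEnt_eq_binEntropy_div (x : ℝ) : binEnt x = binEntropy x / log 2 := by
  unfold binEnt binEntropy logb
  rw [log_inv, log_inv]
  ring

/-- The function `t ↦ H(e⁻ᵗ) / e⁻ᵗ` is concave on `[0, ∞)`, where `H` is the binary entropy. -/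
lemma concaveOn_exp_mul_binEntropy_exp_neg :
    ConcaveOn ℝ (Ici 0) fun t : ℝ ↦ exp t * binEntropy (exp (-t)) := by
  have hexp : ∀ t : ℝ, HasDerivAt (fun s : ℝ ↦ exp (-s)) (-exp (-t)) t := fun t ↦ by
    simpa using (hasDerivAt_neg t).exp
  have hlt : ∀ t : ℝ, 0 < t → exp (-t) < 1 := fun t ht ↦ by
    rw [exp_lt_one_iff]; linarith
  refine concaveOn_of_hasDerivWithinAt2_nonpos (convex_Ici 0)
    (f' := fun t ↦ -(exp t * log (1 - exp (-t))))
    (f'' := fun t ↦ -(exp t * log (1 - exp (-t)) + exp t * (exp (-t) / (1 - exp (-t)))))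
    ?_ ?_ ?_ ?_
  · exact (continuous_exp.mul
      (binEntropy_continuous.comp (continuous_exp.comp continuous_neg))).continuousOn
  · intro t ht
    rw [interior_Ici] at ht
    have h1 := hlt t ht
    have h := (hasDerivAt_exp t).mul
      ((hasDerivAt_binEntropy (exp_pos (-t)).ne' h1.ne).comp t (hexp t))
    refine (h.congr_deriv ?_).hasDerivWithinAt
    simp only [Function.comp_apply, binEntropy, log_inv, log_exp]
    ring
  · intro t ht
    rw [interior_Ici] at ht
    have h1 := hlt t ht
    have h := ((hasDerivAt_exp t).mul (((hexp t).const_sub 1).log (by linarith))).neg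
    refine (h.congr_deriv ?_).hasDerivWithinAt
    ring
  · intro t ht
    rw [interior_Ici] at ht
    have h1 := hlt t ht
    have h2 : 0 < 1 - exp (-t) := by linarith
    have h3 := one_sub_inv_le_log_of_pos h2
    have h4 : exp (-t) / (1 - exp (-t)) = (1 - exp (-t))⁻¹ - 1 := by
      field_simp; ring
    rw [h4, ← mul_add]
    have := mul_nonneg (exp_pos t).le (show 0 ≤ log (1 - exp (-t)) + ((1 - exp (-t))⁻¹ - 1) by
      linarith)
    linarith

/-- Midpoint form of the concavity, in multiplicative notation. -/
lemma sq_mul_binEntropy_add_le {s t : ℝ} (hs : 0 < s) (hs1 : s ≤ 1) (ht : 0 < t) (ht1 : t ≤ 1) :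
    s ^ 2 * binEntropy (t ^ 2) + t ^ 2 * binEntropy (s ^ 2) ≤
      2 * (s * t) * binEntropy (s * t) := by
  have hls : 0 ≤ -log s := by linarith [log_nonpos hs.le hs1]
  have hlt : 0 ≤ -log t := by linarith [log_nonpos ht.le ht1]
  have h := concaveOn_exp_mul_binEntropy_exp_neg.2 (x := 2 * -log s) (y := 2 * -log t)
    (mem_Ici.2 (by linarith)) (mem_Ici.2 (by linarith))
    (show (0 : ℝ) ≤ 1 / 2 by norm_num) (show (0 : ℝ) ≤ 1 / 2 by norm_num) (by norm_num)
  have e1 : exp (-(2 * -log s)) = s ^ 2 := by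
    rw [show -(2 * -log s) = log s + log s by ring, exp_add, exp_log hs]; ring
  have e2 : exp (-(2 * -log t)) = t ^ 2 := by
    rw [show -(2 * -log t) = log t + log t by ring, exp_add, exp_log ht]; ring
  have e3 : exp (-((1 / 2) * (2 * -log s) + (1 / 2) * (2 * -log t))) = s * t := by
    rw [show -((1 / 2) * (2 * -log s) + (1 / 2) * (2 * -log t)) = log s + log t by ring,
      exp_add, exp_log hs, exp_log ht]
  have inv : ∀ x : ℝ, exp x = (exp (-x))⁻¹ := fun x ↦ by rw [exp_neg, inv_inv]
  simp only [smul_eq_mul] at h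
  rw [inv (2 * -log s), inv (2 * -log t),
    inv ((1 / 2) * (2 * -log s) + (1 / 2) * (2 * -log t)), e1, e2, e3] at h
  have h5 := mul_le_mul_of_nonneg_left h (show 0 ≤ 2 * (s ^ 2 * t ^ 2) by positivity)
  calc s ^ 2 * binEntropy (t ^ 2) + t ^ 2 * binEntropy (s ^ 2)
      = 2 * (s ^ 2 * t ^ 2) *
          (1 / 2 * ((s ^ 2)⁻¹ * binEntropy (s ^ 2)) + 1 / 2 * ((t ^ 2)⁻¹ * binEntropy (t ^ 2))) := by
        field_simp
        ring
    _ ≤ 2 * (s ^ 2 * t ^ 2) * ((s * t)⁻¹ * binEntropy (s * t)) := h5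
    _ = 2 * (s * t) * binEntropy (s * t) := by field_simp

/-- The difference `H(x²) - c x H(x)` whose sign is studied below. -/
noncomputable def entropyGap (c x : ℝ) : ℝ := binEntropy (x ^ 2) - c * (x * binEntropy x)

/-- The derivative of `entropyGap c`, in a form that is continuous on `[0, 1)`. -/
noncomputable def entropyGapDeriv (c x : ℝ) : ℝ :=
  2 * x * log (1 - x ^ 2) - (4 - c) * (x * log x) - c * binEntropy x - c * (x * log (1 - x))

lemma continuous_entropyGap (c : ℝ) : Continuous (entropyGap c) := by
  unfold entropyGap
  have := binEntropy_continuous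
  fun_prop

lemma hasDerivAt_entropyGap (c : ℝ) {x : ℝ} (hx : x ∈ Ioo (0 : ℝ) 1) :
    HasDerivAt (entropyGap c) (entropyGapDeriv c x) x := by
  obtain ⟨h0, h1⟩ := hx
  have hsq : x ^ 2 ≠ 1 := by nlinarith
  have hp : HasDerivAt (fun y : ℝ ↦ y ^ 2) (2 * x) x := by simpa using hasDerivAt_pow 2 x
  have hH : HasDerivAt binEntropy (log (1 - x ^ 2) - log (x ^ 2)) (x ^ 2) :=
    hasDerivAt_binEntropy (pow_pos h0 2).ne' hsq
  have h := (HasDerivAt.comp (h := fun y : ℝ ↦ y ^ 2) x hH hp).sub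
    (((hasDerivAt_id x).mul (hasDerivAt_binEntropy h0.ne' h1.ne)).const_mul c)
  refine h.congr_deriv ?_
  simp only [entropyGapDeriv, log_pow, id]
  push_cast
  ring

lemma continuousOn_entropyGapDeriv (c : ℝ) : ContinuousOn (entropyGapDeriv c) (Ico 0 1) := by
  unfold entropyGapDeriv
  have h1 : ContinuousOn (fun x : ℝ ↦ log (1 - x ^ 2)) (Ico 0 1) :=
    ContinuousOn.log (by fun_prop) fun x hx ↦ by have := hx.1; have := hx.2; nlinarith
  have h2 : ContinuousOn (fun x : ℝ ↦ log (1 - x)) (Ico 0 1) :=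
    ContinuousOn.log (by fun_prop) fun x hx ↦ by have := hx.2; linarith
  have h3 := continuous_mul_log.continuousOn (s := Ico (0 : ℝ) 1)
  have h4 := binEntropy_continuous.continuousOn (s := Ico (0 : ℝ) 1)
  fun_prop

lemma hasDerivAt_entropyGapDeriv (c : ℝ) {x : ℝ} (hx : x ∈ Ioo (0 : ℝ) 1) :
    HasDerivAt (entropyGapDeriv c)
      (2 * log (1 - x ^ 2) - 4 * log x - 4 / (1 - x ^ 2) - 2 * c * (log (1 - x) - log x)
        + c / (1 - x)) x := by
  obtain ⟨h0, h1⟩ := hx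
  have hx1 : 1 - x ≠ 0 := by linarith
  have hsq : 1 - x ^ 2 ≠ 0 := by nlinarith
  have hp : HasDerivAt (fun y : ℝ ↦ y ^ 2) (2 * x) x := by simpa using hasDerivAt_pow 2 x
  have h := (((((hasDerivAt_id x).const_mul 2).mul ((hp.const_sub 1).log hsq)).sub
    ((hasDerivAt_mul_log h0.ne').const_mul (4 - c))).sub
    ((hasDerivAt_binEntropy h0.ne' h1.ne).const_mul c)).sub
    (((hasDerivAt_id x).mul (((hasDerivAt_id x).const_sub 1).log hx1)).const_mul c)
  refine h.congr_deriv ?_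
  simp only [id]
  field_simp
  ring

lemma hasDerivAt_entropyGapDeriv_deriv (c : ℝ) {x : ℝ} (hx : x ∈ Ioo (0 : ℝ) 1) :
    HasDerivAt (fun x ↦ 2 * log (1 - x ^ 2) - 4 * log x - 4 / (1 - x ^ 2)
        - 2 * c * (log (1 - x) - log x) + c / (1 - x))
      ((c * (2 + 3 * x - x ^ 3) - 4 - 4 * x ^ 2) / (x * (1 - x ^ 2) ^ 2)) x := by
  obtain ⟨h0, h1⟩ := hx
  have hx1 : 1 - x ≠ 0 := by linarith
  have hx2 : 1 + x ≠ 0 := by linarith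
  have hsq : 1 - x ^ 2 ≠ 0 := by nlinarith
  have hp : HasDerivAt (fun y : ℝ ↦ 1 - y ^ 2) (-(2 * x)) x := by
    simpa using (hasDerivAt_pow 2 x).const_sub 1
  have hq : HasDerivAt (fun y : ℝ ↦ 1 - y) (-1) x := (hasDerivAt_id x).const_sub 1
  have h := (((((hp.log hsq).const_mul 2).sub ((hasDerivAt_log h0.ne').const_mul 4)).sub
    ((hasDerivAt_const x (4 : ℝ)).div hp hsq)).sub
    (((hq.log hx1).sub (hasDerivAt_log h0.ne')).const_mul (2 * c))).add
    ((hasDerivAt_const x c).div hq hx1)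
  refine h.congr_deriv ?_
  rw [show 1 - x ^ 2 = (1 - x) * (1 + x) by ring]
  field_simp
  ring

/-- A cubic with negative sum of roots cannot have three distinct positive roots. -/
lemma entropyGap_cubic_no_three_roots {c p q r : ℝ} (hc : 0 < c) (hp : 0 < p) (hpq : p < q)
    (hqr : q < r) (h1 : c * (2 + 3 * p - p ^ 3) - 4 - 4 * p ^ 2 = 0)
    (h2 : c * (2 + 3 * q - q ^ 3) - 4 - 4 * q ^ 2 = 0)
    (h3 : c * (2 + 3 * r - r ^ 3) - 4 - 4 * r ^ 2 = 0) : False := by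
  have e1 : c * (3 - (p ^ 2 + p * q + q ^ 2)) - 4 * (p + q) = 0 :=
    mul_left_cancel₀ (sub_pos.2 hpq).ne' (by linear_combination h2 - h1)
  have e2 : c * (3 - (q ^ 2 + q * r + r ^ 2)) - 4 * (q + r) = 0 :=
    mul_left_cancel₀ (sub_pos.2 hqr).ne' (by linear_combination h3 - h2)
  have e3 : c * (p + q + r) + 4 = 0 :=
    mul_left_cancel₀ (sub_pos.2 (hpq.trans hqr)).ne' (by linear_combination e1 - e2)
  have : 0 < c * (p + q + r) := mul_pos hc (by linarith)
  linarith

lemma entropyGapDeriv_no_five_zeros {c u v w z : ℝ} (hc : 0 < c) (hu : 0 < u) (huv : u < v)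
    (hvw : v < w) (hwz : w < z) (hz : z < 1) (h0 : entropyGapDeriv c 0 = 0)
    (h1 : entropyGapDeriv c u = 0) (h2 : entropyGapDeriv c v = 0) (h3 : entropyGapDeriv c w = 0)
    (h4 : entropyGapDeriv c z = 0) : False := by
  have rolle : ∀ a b : ℝ, 0 ≤ a → a < b → b < 1 → entropyGapDeriv c a = 0 →
      entropyGapDeriv c b = 0 → ∃ x ∈ Ioo a b,
        2 * log (1 - x ^ 2) - 4 * log x - 4 / (1 - x ^ 2) - 2 * c * (log (1 - x) - log x)
          + c / (1 - x) = 0 := fun a b ha hab hb hfa hfb ↦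
    exists_hasDerivAt_eq_zero hab
      ((continuousOn_entropyGapDeriv c).mono fun x hx ↦ ⟨ha.trans hx.1, hx.2.trans_lt hb⟩)
      (hfa.trans hfb.symm) fun x hx ↦
        hasDerivAt_entropyGapDeriv c ⟨ha.trans_lt hx.1, hx.2.trans hb⟩
  have rolle' : ∀ a b : ℝ, 0 < a → a < b → b < 1 →
      2 * log (1 - a ^ 2) - 4 * log a - 4 / (1 - a ^ 2) - 2 * c * (log (1 - a) - log a)
          + c / (1 - a) = 0 →
      2 * log (1 - b ^ 2) - 4 * log b - 4 / (1 - b ^ 2) - 2 * c * (log (1 - b) - log b)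
          + c / (1 - b) = 0 →
      ∃ x ∈ Ioo a b, c * (2 + 3 * x - x ^ 3) - 4 - 4 * x ^ 2 = 0 := by
    intro a b ha hab hb hfa hfb
    have hd : ∀ x ∈ Icc a b, x ∈ Ioo (0 : ℝ) 1 := fun x hx ↦
      ⟨ha.trans_le hx.1, hx.2.trans_lt hb⟩
    obtain ⟨x, hx, hx0⟩ := exists_hasDerivAt_eq_zero hab
      (fun x hx ↦ (hasDerivAt_entropyGapDeriv_deriv c (hd x hx)).continuousAt.continuousWithinAt)
      (hfa.trans hfb.symm)
      (fun x hx ↦ hasDerivAt_entropyGapDeriv_deriv c (hd x (Ioo_subset_Icc_self hx)))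
    have hx' := hd x (Ioo_subset_Icc_self hx)
    have hne : x * (1 - x ^ 2) ^ 2 ≠ 0 :=
      mul_ne_zero hx'.1.ne' (pow_ne_zero 2 (by have := hx'.1; have := hx'.2; nlinarith))
    exact ⟨x, hx, (div_eq_zero_iff.1 hx0).resolve_right hne⟩
  obtain ⟨a1, m1, z1⟩ := rolle 0 u le_rfl hu (by linarith) h0 h1
  obtain ⟨a2, m2, z2⟩ := rolle u v hu.le huv (by linarith) h1 h2
  obtain ⟨a3, m3, z3⟩ := rolle v w (by linarith) hvw (by linarith) h2 h3
  obtain ⟨a4, m4, z4⟩ := rolle w z (by linarith) hwz hz h3 h4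
  simp only [mem_Ioo] at m1 m2 m3 m4
  obtain ⟨b1, n1, y1⟩ := rolle' a1 a2 m1.1 (by linarith) (by linarith) z1 z2
  obtain ⟨b2, n2, y2⟩ := rolle' a2 a3 (by linarith) (by linarith) (by linarith) z2 z3
  obtain ⟨b3, n3, y3⟩ := rolle' a3 a4 (by linarith) (by linarith) (by linarith) z3 z4
  simp only [mem_Ioo] at n1 n2 n3
  exact entropyGap_cubic_no_three_roots hc (by linarith) (by linarith) (by linarith) y1 y2 y3

section GoldenRatio

variable {φ : ℝ}

lemma entropyGap_ne_zero (hφ0 : 0 < φ) (hφ : φ ^ 2 + φ - 1 = 0) {a : ℝ} (ha : a ∈ Ioo (0 : ℝ) 1)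
    (hne : a ≠ φ) : entropyGap φ⁻¹ a ≠ 0 := by
  intro hfa
  have hφ1 : φ < 1 := by nlinarith
  have hc : 0 < φ⁻¹ := inv_pos.2 hφ0
  have e1 : 1 - φ ^ 2 = φ := by linarith
  have e2 : 1 - φ = φ ^ 2 := by linarith
  have f0 : entropyGap φ⁻¹ 0 = 0 := by simp [entropyGap]
  have f1 : entropyGap φ⁻¹ 1 = 0 := by simp [entropyGap]
  have fφ : entropyGap φ⁻¹ φ = 0 := by
    rw [entropyGap, ← e2, binEntropy_one_sub, inv_mul_cancel_left₀ hφ0.ne', sub_self]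
  have d0 : entropyGapDeriv φ⁻¹ 0 = 0 := by simp [entropyGapDeriv]
  have dφ : entropyGapDeriv φ⁻¹ φ = 0 := by
    rw [entropyGapDeriv, binEntropy, log_inv, log_inv, e1, e2, log_pow]
    push_cast
    field_simp
    ring
  have rolle : ∀ x y : ℝ, 0 ≤ x → x < y → y ≤ 1 → entropyGap φ⁻¹ x = 0 → entropyGap φ⁻¹ y = 0 →
      ∃ u ∈ Ioo x y, entropyGapDeriv φ⁻¹ u = 0 := fun x y hx hxy hy hfx hfy ↦
    exists_hasDerivAt_eq_zero hxy (continuous_entropyGap _).continuousOn (hfx.trans hfy.symm)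
      fun u hu ↦ hasDerivAt_entropyGap _ ⟨hx.trans_lt hu.1, hu.2.trans_le hy⟩
  rcases lt_or_gt_of_ne hne with h | h
  · obtain ⟨u, hu, zu⟩ := rolle 0 a le_rfl ha.1 ha.2.le f0 hfa
    obtain ⟨v, hv, zv⟩ := rolle a φ ha.1.le h hφ1.le hfa fφ
    obtain ⟨w, hw, zw⟩ := rolle φ 1 hφ0.le hφ1 le_rfl fφ f1
    exact entropyGapDeriv_no_five_zeros hc hu.1 (hu.2.trans hv.1) hv.2 hw.1 hw.2 d0 zu zv dφ zw
  · obtain ⟨u, hu, zu⟩ := rolle 0 φ le_rfl hφ0 hφ1.le f0 fφ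
    obtain ⟨v, hv, zv⟩ := rolle φ a hφ0.le h ha.2.le fφ hfa
    obtain ⟨w, hw, zw⟩ := rolle a 1 ha.1.le ha.2 le_rfl hfa f1
    exact entropyGapDeriv_no_five_zeros hc hu.1 hu.2 hv.1 (hv.2.trans hw.1) hw.2 d0 zu dφ zv zw

lemma log_three_le : 29 * log 3 ≤ 46 * log 2 := by
  have h := log_le_log (by norm_num) (show (3 : ℝ) ^ 29 ≤ 2 ^ 46 by norm_num)
  simpa only [log_pow, Nat.cast_ofNat] using h

lemma log_seven_le : 16 * log 7 ≤ 45 * log 2 := by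
  have h := log_le_log (by norm_num) (show (7 : ℝ) ^ 16 ≤ 2 ^ 45 by norm_num)
  simpa only [log_pow, Nat.cast_ofNat] using h

lemma binEntropy_one_quarter : binEntropy (1 / 4) = 2 * log 2 - 3 / 4 * log 3 := by
  rw [binEntropy, log_inv, log_inv, show (1 : ℝ) - 1 / 4 = 3 / 4 by norm_num,
    log_div (by norm_num) (by norm_num), log_div (by norm_num) (by norm_num), log_one, log_four_eq]
  ring

lemma binEntropy_nine_sixteenths :
    binEntropy (9 / 16) = 4 * log 2 - 9 / 8 * log 3 - 7 / 16 * log 7 := by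
  rw [binEntropy, log_inv, log_inv, show (1 : ℝ) - 9 / 16 = 7 / 16 by norm_num,
    log_div (by norm_num) (by norm_num), log_div (by norm_num) (by norm_num),
    show (9 : ℝ) = 3 ^ 2 by norm_num, show (16 : ℝ) = 2 ^ 4 by norm_num, log_pow, log_pow]
  push_cast
  ring

lemma entropyGap_nonneg (hφ0 : 0 < φ) (hφ : φ ^ 2 + φ - 1 = 0) {x : ℝ} (hx : x ∈ Icc (0 : ℝ) 1) :
    0 ≤ entropyGap φ⁻¹ x := by
  have hl : 0 < log 2 := log_pos (by norm_num)
  have hinv : φ⁻¹ = φ + 1 := by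
    exact inv_eq_of_mul_eq_one_right (by linarith)
  have hφu : φ < 0.6181 := by nlinarith
  have hφl : 0.618 < φ := by nlinarith
  have half : 0 < entropyGap φ⁻¹ (1 / 2) := by
    have h2 : binEntropy (1 / 2) = log 2 := by
      rw [one_div]; exact binEntropy_two_inv
    rw [entropyGap, show ((1 : ℝ) / 2) ^ 2 = 1 / 4 by norm_num, binEntropy_one_quarter, h2, hinv]
    nlinarith [log_three_le]
  have threeQuarters : 0 < entropyGap φ⁻¹ (3 / 4) := by
    have h34 : binEntropy (3 / 4) = binEntropy (1 / 4) := by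
      rw [← binEntropy_one_sub]; norm_num
    rw [entropyGap, show ((3 : ℝ) / 4) ^ 2 = 9 / 16 by norm_num, binEntropy_nine_sixteenths,
      h34, binEntropy_one_quarter, hinv]
    have hpos : 0 ≤ 2 * log 2 - 3 / 4 * log 3 := by linarith [log_three_le]
    have hm := mul_le_mul_of_nonneg_right hφu.le hpos
    linarith [log_three_le, log_seven_le]
  have key : ∀ b ∈ Ioo (0 : ℝ) 1, 0 < entropyGap φ⁻¹ b → φ ∉ uIcc x b → x ∈ Ioo (0 : ℝ) 1 →
      0 ≤ entropyGap φ⁻¹ x := by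
    intro b hb hfb hφb hx'
    by_contra! hneg
    obtain ⟨z, hz, hz0⟩ := intermediate_value_uIcc (a := x) (b := b)
      (continuous_entropyGap φ⁻¹).continuousOn
      (mem_uIcc_of_le hneg.le hfb.le)
    have hz01 : z ∈ Ioo (0 : ℝ) 1 := (ordConnected_Ioo.uIcc_subset hx' hb) hz
    exact entropyGap_ne_zero hφ0 hφ hz01 (fun h ↦ hφb (h ▸ hz)) hz0
  rcases hx.1.eq_or_lt with rfl | h0
  · simp [entropyGap]
  rcases hx.2.eq_or_lt with rfl | h1
  · simp [entropyGap]
  rcases lt_trichotomy x φ with h | rfl | h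
  · exact key (1 / 2) (by norm_num) half
      (fun hm ↦ not_lt.2 hm.2 (max_lt h (by linarith))) ⟨h0, h1⟩
  · have e2 : 1 - x = x ^ 2 := by linarith
    rw [entropyGap, ← e2, binEntropy_one_sub, inv_mul_cancel_left₀ hφ0.ne', sub_self]
  · exact key (3 / 4) (by norm_num) threeQuarters
      (fun hm ↦ not_lt.2 hm.1 (lt_min h (by linarith))) ⟨h0, h1⟩

lemma binEntropy_mul_ge (hφ0 : 0 < φ) (hφ : φ ^ 2 + φ - 1 = 0) {x y : ℝ} (hx : x ∈ Icc (0 : ℝ) 1)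
    (hy : y ∈ Icc (0 : ℝ) 1) :
    1 / (2 * φ) * (x * binEntropy y + y * binEntropy x) ≤ binEntropy (x * y) := by
  rcases hx.1.eq_or_lt with rfl | hx0
  · simp
  rcases hy.1.eq_or_lt with rfl | hy0
  · simp
  have hs := sqrt_pos.2 hx0
  have ht := sqrt_pos.2 hy0
  have hs1 : √x ≤ 1 := sqrt_le_one.2 hx.2
  have ht1 : √y ≤ 1 := sqrt_le_one.2 hy.2
  have hmid := sq_mul_binEntropy_add_le hs hs1 ht ht1
  have hgap := entropyGap_nonneg hφ0 hφ
    (x := √x * √y) ⟨by positivity, mul_le_one₀ hs1 ht.le ht1⟩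
  rw [entropyGap, mul_pow] at hgap
  rw [sq_sqrt hx.1, sq_sqrt hy.1] at hmid hgap
  calc 1 / (2 * φ) * (x * binEntropy y + y * binEntropy x)
      ≤ 1 / (2 * φ) * (2 * (√x * √y) * binEntropy (√x * √y)) := by gcongr
    _ = φ⁻¹ * (√x * √y * binEntropy (√x * √y)) := by field_simp
    _ ≤ binEntropy (x * y) := by linarith

end GoldenRatio

/-- For all `x, y ∈ [0,1]`, `h(xy) ≥ (1/(2φ)) (x h(y) + y h(x))`, where `φ = (√5-1)/2`. -/
theorem h_analytic (x y : ℝ) (hx : x ∈ Set.Icc (0 : ℝ) 1) (hy : y ∈ Set.Icc (0 : ℝ) 1) :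
    binEnt (x * y) ≥
      1 / (2 * ((Real.sqrt 5 - 1) / 2)) * (x * binEnt y + y * binEnt x) := by
  have h5 : √(5 : ℝ) ^ 2 = 5 := sq_sqrt (by norm_num)
  have h1 : 1 < √(5 : ℝ) := lt_sqrt_of_sq_lt (by norm_num)
  have h := binEntropy_mul_ge (φ := (√5 - 1) / 2) (by linarith) (by linarith) hx hy
  simp only [binEnt_eq_binEntropy_div]
  have hl : 0 < log 2 := log_pos (by norm_num)
  calc 1 / (2 * ((√5 - 1) / 2)) * (x * (binEntropy y / log 2) + y * (binEntropy x / log 2))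
      = 1 / (2 * ((√5 - 1) / 2)) * (x * binEntropy y + y * binEntropy x) / log 2 := by ring
    _ ≤ binEntropy (x * y) / log 2 := by gcongr
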